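/- Under the Algorithm 1 setup, let {y_t} be an arbitrary sequence with y_t = col(y_{1,t},…,y_{n,t}) ∈ X. Then for every t ∈ ℕ₊ the iterates of Algorithm 1 satisfy (q̄_t)ᵀ g_t(x_t) + f_t(x_t) − f_t(y_t) ≤ (q̄_t)ᵀ g_t(y_t) + 2E₁(t+1) + E₂(t+1) + 4nG²α_{t+1}/σ̲ + (K/α_{t+1}) Σ_{i=1}^n ‖y_{i,t+1} − Φ_{i,t+1}(y_{i,t})‖ − Σ_{i=1}^n (q̃_{i,t+1})ᵀ ∇g_{i,t}(x_{i,t})(x̃_{i,t+1} − x_{i,t}) − (σ̲/(4α_{t+1})) Σ_{i=1}^n ‖x̃_{i,t+1} − x_{i,t}‖², where E₁(t) = n²τB₁F Σ_{s=1}^{t−1} γ_{s+1} λ^{t−1−s} with τ = (1 − w/(2n²))^{−2}, λ = (1 − w/(2n²))^{1/ι}, B₁ = 2F + G·d(X), and E₂(t) = (1/α_t) Σ_{i=1}^n [D_{ψ_i}(y_{i,t−1}, x_{i,t−1}) − D_{ψ_i}(y_{i,t}, x_{i,t})]. -/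

import Mathlib

open scoped RealInnerProductSpace

noncomputable section

/-- Bregman divergence generated by `ψ` with gradient map `ψ'`. -/
def breg {d : ℕ} (ψ : EuclideanSpace ℝ (Fin d) → ℝ)
    (ψ' : EuclideanSpace ℝ (Fin d) → EuclideanSpace ℝ (Fin d))
    (x y : EuclideanSpace ℝ (Fin d)) : ℝ :=
  ψ x - ψ y - ⟪ψ' y, x - y⟫

/-- Componentwise positive part `[v]₊`. -/
def posPart {d : ℕ} (v : EuclideanSpace ℝ (Fin d)) : EuclideanSpace ℝ (Fin d) :=
  (WithLp.equiv 2 (Fin d → ℝ)).symm fun j => max (v j) 0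

/-- Build a Euclidean vector from a coordinate function. -/
def vecOf {d : ℕ} (v : Fin d → ℝ) : EuclideanSpace ℝ (Fin d) :=
  (WithLp.equiv 2 (Fin d → ℝ)).symm v

/-- Stack a family of per-agent vectors into the Euclidean product space. -/
def stack {n : ℕ} {p : Fin n → ℕ} (y : ∀ i, EuclideanSpace ℝ (Fin (p i))) :
    PiLp 2 (fun i => EuclideanSpace ℝ (Fin (p i))) :=
  (WithLp.equiv 2 (∀ i, EuclideanSpace ℝ (Fin (p i)))).symm y

/-- The setup and iterates of Algorithm 1 (distributed online primal-dual
dynamic mirror descent) of the paper. -/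
structure Alg (n m : ℕ) (p : Fin n → ℕ) where
  hn : 0 < n
  hm : 0 < m
  X : ∀ i : Fin n, Set (EuclideanSpace ℝ (Fin (p i)))
  hXconvex : ∀ i, Convex ℝ (X i)
  hXcompact : ∀ i, IsCompact (X i)
  hXnonempty : ∀ i, (X i).Nonempty
  dX : ℝ
  hdX : 0 < dX
  hdiam : ∀ u v : PiLp 2 (fun i => EuclideanSpace ℝ (Fin (p i))),
    (∀ i, u i ∈ X i) → (∀ i, v i ∈ X i) → ‖u - v‖ ≤ dX
  f : ℕ → ∀ i : Fin n, EuclideanSpace ℝ (Fin (p i)) → ℝ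
  r : ℕ → ∀ i : Fin n, EuclideanSpace ℝ (Fin (p i)) → ℝ
  g : ℕ → ∀ i : Fin n, EuclideanSpace ℝ (Fin (p i)) → EuclideanSpace ℝ (Fin m)
  hf0 : ∀ i z, f 0 i z = 0
  hr0 : ∀ i z, r 0 i z = 0
  hg0 : ∀ i z, g 0 i z = 0
  hfconvex : ∀ t i, ConvexOn ℝ (X i) (f t i)
  hrconvex : ∀ t i, ConvexOn ℝ (X i) (r t i)
  hgconvex : ∀ t i (j : Fin m), ConvexOn ℝ (X i) (fun z => g t i z j)
  F : ℝ
  hF : 0 < F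
  G : ℝ
  hG : 0 < G
  hfbound : ∀ t i, ∀ z ∈ X i, |f t i z| ≤ F
  hrbound : ∀ t i, ∀ z ∈ X i, |r t i z| ≤ F
  hgbound : ∀ t i, ∀ z ∈ X i, ‖g t i z‖ ≤ F
  Gf : ℕ → ∀ i : Fin n, EuclideanSpace ℝ (Fin (p i)) → EuclideanSpace ℝ (Fin (p i))
  Gr : ℕ → ∀ i : Fin n, EuclideanSpace ℝ (Fin (p i)) → EuclideanSpace ℝ (Fin (p i))
  Gg : ℕ → ∀ i : Fin n, EuclideanSpace ℝ (Fin (p i)) → Fin m → EuclideanSpace ℝ (Fin (p i))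
  hGfsub : ∀ t i, ∀ z ∈ X i, ∀ u ∈ X i, f t i z + ⟪Gf t i z, u - z⟫ ≤ f t i u
  hGrsub : ∀ t i, ∀ z ∈ X i, ∀ u ∈ X i, r t i z + ⟪Gr t i z, u - z⟫ ≤ r t i u
  hGgsub : ∀ t i, ∀ z ∈ X i, ∀ (j : Fin m), ∀ u ∈ X i,
    g t i z j + ⟪Gg t i z j, u - z⟫ ≤ g t i u j
  hGfbound : ∀ t i, ∀ z ∈ X i, ‖Gf t i z‖ ≤ G
  hGrbound : ∀ t i, ∀ z ∈ X i, ‖Gr t i z‖ ≤ G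
  hGgbound : ∀ t i, ∀ z ∈ X i, ∀ v, ‖vecOf (fun j => ⟪Gg t i z j, v⟫)‖ ≤ G * ‖v‖
  W : ℕ → Matrix (Fin n) (Fin n) ℝ
  hWnonneg : ∀ t i j, 0 ≤ W t i j
  hWrow : ∀ t i, ∑ j, W t i j = 1
  hWcol : ∀ t j, ∑ i, W t i j = 1
  w : ℝ
  hw0 : 0 < w
  hw1 : w < 1
  hWdiag : ∀ t i, w ≤ W t i i
  hWpos : ∀ t i j, 0 < W t i j → w ≤ W t i j
  iota : ℕ
  hiota : 0 < iota
  hconn : ∀ (t : ℕ) (c d : Fin n),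
    Relation.ReflTransGen (fun u v : Fin n => ∃ l < iota, 0 < W (t + l) v u) c d
  ψ : ∀ i : Fin n, EuclideanSpace ℝ (Fin (p i)) → ℝ
  ψ' : ∀ i : Fin n, EuclideanSpace ℝ (Fin (p i)) → EuclideanSpace ℝ (Fin (p i))
  hψgrad : ∀ i z, HasGradientAt (ψ i) (ψ' i z) z
  σ : Fin n → ℝ
  hσ : ∀ i, 0 < σ i
  hψstrong : ∀ i, ∀ z ∈ X i, ∀ u ∈ X i,
    ψ i u + ⟪ψ' i u, z - u⟫ + σ i / 2 * ‖z - u‖ ^ 2 ≤ ψ i z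
  K : ℝ
  hK : 0 < K
  hbregLip : ∀ i, ∀ z₁ ∈ X i, ∀ z₂ ∈ X i, ∀ u ∈ X i,
    |breg (ψ i) (ψ' i) z₁ u - breg (ψ i) (ψ' i) z₂ u| ≤ K * ‖z₁ - z₂‖
  Φ : ℕ → ∀ i : Fin n, EuclideanSpace ℝ (Fin (p i)) → EuclideanSpace ℝ (Fin (p i))
  hΦmaps : ∀ t i, ∀ z ∈ X i, Φ t i z ∈ X i
  hΦcontract : ∀ t i, ∀ z ∈ X i, ∀ u ∈ X i,
    breg (ψ i) (ψ' i) (Φ t i z) (Φ t i u) ≤ breg (ψ i) (ψ' i) z u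
  α : ℕ → ℝ
  β : ℕ → ℝ
  γ : ℕ → ℝ
  hαpos : ∀ t, 1 ≤ t → 0 < α t
  hβpos : ∀ t, 1 ≤ t → 0 < β t
  hγpos : ∀ t, 1 ≤ t → 0 < γ t
  hαanti : ∀ s t, 1 ≤ s → s ≤ t → α t ≤ α s
  hβanti : ∀ s t, 1 ≤ s → s ≤ t → β t ≤ β s
  hγanti : ∀ s t, 1 ≤ s → s ≤ t → γ t ≤ γ s
  x : ℕ → ∀ i : Fin n, EuclideanSpace ℝ (Fin (p i))
  xtil : ℕ → ∀ i : Fin n, EuclideanSpace ℝ (Fin (p i))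
  q : ℕ → Fin n → EuclideanSpace ℝ (Fin m)
  qtil : ℕ → Fin n → EuclideanSpace ℝ (Fin m)
  a : ℕ → ∀ i : Fin n, EuclideanSpace ℝ (Fin (p i))
  b : ℕ → Fin n → EuclideanSpace ℝ (Fin m)
  hx0 : ∀ i, x 0 i ∈ X i
  hq0 : ∀ i, q 0 i = 0
  hqtil : ∀ t, 1 ≤ t → ∀ i, qtil t i = ∑ j, W (t - 1) i j • q (t - 1) j
  ha : ∀ t, 1 ≤ t → ∀ i,
    a t i = Gf (t - 1) i (x (t - 1) i) + ∑ j, qtil t i j • Gg (t - 1) i (x (t - 1) i) j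
  hxtilmem : ∀ t, 1 ≤ t → ∀ i, xtil t i ∈ X i
  hxtilmin : ∀ t, 1 ≤ t → ∀ i, ∀ z ∈ X i,
    α t * ⟪xtil t i, a t i⟫ + α t * r (t - 1) i (xtil t i)
        + breg (ψ i) (ψ' i) (xtil t i) (x (t - 1) i)
      ≤ α t * ⟪z, a t i⟫ + α t * r (t - 1) i z + breg (ψ i) (ψ' i) z (x (t - 1) i)
  hb : ∀ t, 1 ≤ t → ∀ i,
    b t i = vecOf (fun j => ⟪Gg (t - 1) i (x (t - 1) i) j, xtil t i - x (t - 1) i⟫)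
      + g (t - 1) i (x (t - 1) i)
  hq : ∀ t, 1 ≤ t → ∀ i,
    q t i = posPart (qtil t i + γ t • (b t i - β t • qtil t i))
  hx : ∀ t, 1 ≤ t → ∀ i, x t i = Φ t i (xtil t i)

namespace Alg

variable {n m : ℕ} {p : Fin n → ℕ}

/-- Average dual variable `q̄_t`. -/
def qbar (S : Alg n m p) (t : ℕ) : EuclideanSpace ℝ (Fin m) :=
  (n : ℝ)⁻¹ • ∑ i, S.q t i

/-- `σ̲ = min_i σ_i`. -/
def sigmin (S : Alg n m p) : ℝ :=
  Finset.univ.inf' (Finset.univ_nonempty_iff.mpr ⟨⟨0, S.hn⟩⟩) S.σ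

/-- `τ = (1 − w/(2n²))⁻²`. -/
def tau (S : Alg n m p) : ℝ := ((1 - S.w / (2 * (n : ℝ) ^ 2)) ^ 2)⁻¹

/-- `λ = (1 − w/(2n²))^{1/ι}`. -/
def lam (S : Alg n m p) : ℝ := (1 - S.w / (2 * (n : ℝ) ^ 2)) ^ ((S.iota : ℝ))⁻¹

/-- `B₁ = 2F + G d(X)`. -/
def B1 (S : Alg n m p) : ℝ := 2 * S.F + S.G * S.dX

/-- `E₁(t) = n²τB₁F Σ_{s=1}^{t−1} γ_{s+1} λ^{t−1−s}`. -/
def E1 (S : Alg n m p) (t : ℕ) : ℝ :=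
  (n : ℝ) ^ 2 * S.tau * S.B1 * S.F *
    ∑ s ∈ Finset.Icc 1 (t - 1), S.γ (s + 1) * S.lam ^ (t - 1 - s)

/-- Global objective `f_t(y) = Σ_i (f_{i,t}(y_i) + r_{i,t}(y_i))`. -/
def fsum (S : Alg n m p) (t : ℕ) (y : ∀ i, EuclideanSpace ℝ (Fin (p i))) : ℝ :=
  ∑ i, (S.f t i (y i) + S.r t i (y i))

/-- Global constraint `g_t(y) = Σ_i g_{i,t}(y_i)`. -/
def gsum (S : Alg n m p) (t : ℕ) (y : ∀ i, EuclideanSpace ℝ (Fin (p i))) :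
    EuclideanSpace ℝ (Fin m) :=
  ∑ i, S.g t i (y i)

/-- Regret against a comparator sequence. -/
def reg (S : Alg n m p) (T : ℕ) (y : ℕ → ∀ i, EuclideanSpace ℝ (Fin (p i))) : ℝ :=
  ∑ t ∈ Finset.Icc 1 T, S.fsum t (S.x t) - ∑ t ∈ Finset.Icc 1 T, S.fsum t (y t)

/-- Feasibility of a comparator sequence on `1..T`. -/
def Feasible (S : Alg n m p) (T : ℕ) (y : ℕ → ∀ i, EuclideanSpace ℝ (Fin (p i))) : Prop :=
  ∀ t ∈ Finset.Icc 1 T, (∀ i, y t i ∈ S.X i) ∧ ∀ j, S.gsum t (y t) j ≤ 0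

/-- Accumulated dynamic variation `V_Φ(y_T)`. -/
def VPhi (S : Alg n m p) (T : ℕ) (y : ℕ → ∀ i, EuclideanSpace ℝ (Fin (p i))) : ℝ :=
  ∑ t ∈ Finset.Icc 1 (T - 1), ∑ i, ‖y (t + 1) i - S.Φ (t + 1) i (y t i)‖

/-- `E₂(t)` for a comparator sequence. -/
def E2 (S : Alg n m p) (y : ℕ → ∀ i, EuclideanSpace ℝ (Fin (p i))) (t : ℕ) : ℝ :=
  (S.α t)⁻¹ * ∑ i, (breg (S.ψ i) (S.ψ' i) (y (t - 1) i) (S.x (t - 1) i)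
    - breg (S.ψ i) (S.ψ' i) (y t i) (S.x t i))

/-- `C_{1,1} = 3n²τB₁F/(1−λ) + nB₁²/2`. -/
def C11 (S : Alg n m p) : ℝ :=
  3 * (n : ℝ) ^ 2 * S.tau * S.B1 * S.F / (1 - S.lam) + (n : ℝ) * S.B1 ^ 2 / 2

/-- `C_{1,2} = 4nG²/σ̲`. -/
def C12 (S : Alg n m p) : ℝ := 4 * (n : ℝ) * S.G ^ 2 / S.sigmin

/-- Constraint violation `‖[Σ_{t=1}^T g_t(x_t)]₊‖`. -/
def violation (S : Alg n m p) (T : ℕ) : ℝ :=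
  ‖posPart (∑ t ∈ Finset.Icc 1 T, S.gsum t (S.x t))‖

end Alg

section Mixing

variable {V : Type*} [Fintype V]

theorem two_mul_variance_eq (c x : V → ℝ) (hc : ∑ i, c i = 1) :
    2 * (∑ i, c i * x i ^ 2 - (∑ i, c i * x i) ^ 2) =
      ∑ i, ∑ j, c i * c j * (x i - x j) ^ 2 := by
  have h : ∀ i j, c i * c j * (x i - x j) ^ 2 =
      c i * x i ^ 2 * c j + c i * (c j * x j ^ 2) - 2 * (c i * x i * (c j * x j)) := by
    intro i j; ring
  simp_rw [h, Finset.sum_sub_distrib, Finset.sum_add_distrib, ← Finset.mul_sum,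
    ← Finset.sum_mul, hc]
  ring

/-- The squared gaps of a level sequence `u` lying between `a` and `b` sum to at most
`(b - a) ^ 2`. -/
theorem sum_sq_gap_le {u : ℕ → ℝ} (hu : Monotone u) (D : Finset ℕ) {a b : ℝ}
    (ha : ∀ d ∈ D, a ≤ u d) (hb : ∀ d ∈ D, u (d + 1) ≤ b) :
    ∑ d ∈ D, (u (d + 1) - u d) ^ 2 ≤ (b - a) ^ 2 := by
  rcases D.eq_empty_or_nonempty with rfl | hD
  · simpa using sq_nonneg (b - a)
  have hnn : ∀ d, 0 ≤ u (d + 1) - u d := fun d => sub_nonneg.2 (hu d.le_succ)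
  have h1 : ∑ d ∈ D, (u (d + 1) - u d) ≤ b - a := by
    calc ∑ d ∈ D, (u (d + 1) - u d)
        ≤ ∑ d ∈ Finset.Ico (D.min' hD) (D.max' hD + 1), (u (d + 1) - u d) := by
          refine Finset.sum_le_sum_of_subset_of_nonneg (fun d hd => ?_) fun d _ _ => hnn d
          have := D.min'_le d hd
          have := D.le_max' d hd
          simp; omega
      _ = u (D.max' hD + 1) - u (D.min' hD) :=
          Finset.sum_Ico_sub u ((D.min'_le_max' hD).trans (Nat.le_succ _))
      _ ≤ b - a := sub_le_sub (hb _ (D.max'_mem hD)) (ha _ (D.min'_mem hD))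
  calc ∑ d ∈ D, (u (d + 1) - u d) ^ 2 ≤ (∑ d ∈ D, (u (d + 1) - u d)) ^ 2 :=
        Finset.sum_sq_le_sq_sum_of_nonneg fun d _ => hnn d
    _ ≤ (b - a) ^ 2 := pow_le_pow_left₀ (Finset.sum_nonneg fun d _ => hnn d) h1 2

/-- The vector `x` respects the cut at level `d` of the ranking `rk`. -/
def RespectsCut (rk : V → ℕ) (u : ℕ → ℝ) (x : V → ℝ) (d : ℕ) : Prop :=
  ∀ i, (rk i ≤ d → x i ≤ u d) ∧ (d < rk i → u (d + 1) ≤ x i)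

/-- The weights `A` join the two sides of the cut at level `d` of the ranking `rk`. -/
def CrossesCut (rk : V → ℕ) (A : Matrix V V ℝ) (d : ℕ) : Prop :=
  ∃ k l, 0 < A k l ∧ ¬ (rk k ≤ d ↔ rk l ≤ d)

theorem sum_gap_mul_le_variance {rk : V → ℕ} {u : ℕ → ℝ} (hu : Monotone u) (c x : V → ℝ)
    (hc0 : ∀ i, 0 ≤ c i) (hc : ∑ i, c i = 1) (D : Finset ℕ)
    (hD : ∀ d ∈ D, RespectsCut rk u x d) :
    ∑ d ∈ D, (u (d + 1) - u d) ^ 2 *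
        ((∑ i, if rk i ≤ d then c i else 0) * ∑ i, if rk i ≤ d then 0 else c i) ≤
      ∑ i, c i * x i ^ 2 - (∑ i, c i * x i) ^ 2 := by
  set s : V → V → ℕ → ℝ := fun i j d =>
    if rk i ≤ d ∧ d < rk j then (u (d + 1) - u d) ^ 2 else 0 with hs
  have key : ∀ i j, ∑ d ∈ D, (s i j d + s j i d) ≤ (x i - x j) ^ 2 := by
    have half : ∀ i j, rk i ≤ rk j → ∑ d ∈ D, (s i j d + s j i d) ≤ (x i - x j) ^ 2 := by
      intro i j hij
      have h0 : ∀ d, s j i d = 0 := by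
        intro d; simp only [hs]; rw [if_neg]; omega
      simp only [h0, add_zero]
      simp only [hs, ← Finset.sum_filter]
      rw [← neg_sub, neg_sq]
      refine sum_sq_gap_le hu _ (fun d hd => ?_) fun d hd => ?_
      · rw [Finset.mem_filter] at hd; exact (hD d hd.1 i).1 hd.2.1
      · rw [Finset.mem_filter] at hd; exact (hD d hd.1 j).2 hd.2.2
    intro i j
    rcases le_total (rk i) (rk j) with h | h
    · exact half i j h
    · have := half j i h
      rw [← neg_sub, neg_sq]
      simpa only [add_comm] using this
  have hprod : ∀ d, (u (d + 1) - u d) ^ 2 *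
        ((∑ i, if rk i ≤ d then c i else 0) * ∑ i, if rk i ≤ d then 0 else c i) =
      ∑ i, ∑ j, c i * c j * s i j d := by
    intro d
    rw [Finset.sum_mul_sum, Finset.mul_sum]
    refine Finset.sum_congr rfl fun i _ => ?_
    rw [Finset.mul_sum]
    refine Finset.sum_congr rfl fun j _ => ?_
    simp only [hs]
    by_cases h1 : rk i ≤ d <;> by_cases h2 : rk j ≤ d
    · simp [h1, h2, not_lt.2 h2]
    · simp [h1, h2, not_le.1 h2]; ring
    · simp [h1]
    · simp [h1]
  have h2 : 2 * ∑ d ∈ D, (u (d + 1) - u d) ^ 2 *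
        ((∑ i, if rk i ≤ d then c i else 0) * ∑ i, if rk i ≤ d then 0 else c i) =
      ∑ i, ∑ j, c i * c j * ∑ d ∈ D, (s i j d + s j i d) := by
    simp_rw [hprod, Finset.sum_add_distrib, mul_add, Finset.sum_add_distrib, two_mul,
      Finset.mul_sum]
    congr 1
    · rw [Finset.sum_comm]
      exact Finset.sum_congr rfl fun i _ => Finset.sum_comm
    · rw [Finset.sum_comm]
      rw [Finset.sum_congr rfl fun i _ => Finset.sum_comm, Finset.sum_comm]
      refine Finset.sum_congr rfl fun i _ => Finset.sum_congr rfl fun j _ =>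
        Finset.sum_congr rfl fun d _ => ?_
      ring
  have h3 : ∑ i, ∑ j, c i * c j * ∑ d ∈ D, (s i j d + s j i d) ≤
      ∑ i, ∑ j, c i * c j * (x i - x j) ^ 2 :=
    Finset.sum_le_sum fun i _ => Finset.sum_le_sum fun j _ =>
      mul_le_mul_of_nonneg_left (key i j) (mul_nonneg (hc0 i) (hc0 j))
  rw [← h2, ← two_mul_variance_eq c x hc] at h3
  linarith

/-- Doubly stochastic weights whose diagonal and positive entries are at least `w`. -/
structure IsMixing (w : ℝ) (A : Matrix V V ℝ) : Prop where
  nonneg : ∀ i j, 0 ≤ A i j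
  row : ∀ i, ∑ j, A i j = 1
  col : ∀ j, ∑ i, A i j = 1
  diag : ∀ i, w ≤ A i i
  pos : ∀ i j, 0 < A i j → w ≤ A i j

theorem IsMixing.half_le_sum_cut {w : ℝ} (hw : 0 < w) {A : Matrix V V ℝ} (hA : IsMixing w A)
    {rk : V → ℕ} {d : ℕ} (hd : CrossesCut rk A d) :
    w / 2 ≤ ∑ k, (∑ i, if rk i ≤ d then A k i else 0) *
      ∑ i, if rk i ≤ d then 0 else A k i := by
  obtain ⟨k, l, hkl, hcut⟩ := hd
  have nn1 : ∀ k i, 0 ≤ if rk i ≤ d then A k i else 0 := by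
    intro k i; split_ifs; exacts [hA.nonneg k i, le_rfl]
  have nn2 : ∀ k i, 0 ≤ if rk i ≤ d then 0 else A k i := by
    intro k i; split_ifs; exacts [le_rfl, hA.nonneg k i]
  have hsum : (∑ i, if rk i ≤ d then A k i else 0) + (∑ i, if rk i ≤ d then 0 else A k i) = 1 := by
    rw [← Finset.sum_add_distrib, ← hA.row k]
    exact Finset.sum_congr rfl fun i _ => by split_ifs <;> simp
  have b1 : ∀ i, rk i ≤ d → w ≤ A k i → w ≤ ∑ i, if rk i ≤ d then A k i else 0 := by
    intro i hi h
    refine h.trans ?_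
    have := Finset.single_le_sum (fun i _ => nn1 k i) (Finset.mem_univ i)
    simpa [hi] using this
  have b2 : ∀ i, ¬ rk i ≤ d → w ≤ A k i → w ≤ ∑ i, if rk i ≤ d then 0 else A k i := by
    intro i hi h
    refine h.trans ?_
    have := Finset.single_le_sum (fun i _ => nn2 k i) (Finset.mem_univ i)
    simpa [hi] using this
  have hle : w ≤ (∑ i, if rk i ≤ d then A k i else 0) ∧
      w ≤ ∑ i, if rk i ≤ d then 0 else A k i := by
    by_cases hk : rk k ≤ d
    · have hl : ¬ rk l ≤ d := fun h => hcut ⟨fun _ => h, fun _ => hk⟩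
      exact ⟨b1 k hk (hA.diag k), b2 l hl (hA.pos k l hkl)⟩
    · have hl : rk l ≤ d := by
        by_contra h; exact hcut ⟨fun h' => absurd h' hk, fun h' => absurd h' h⟩
      exact ⟨b1 l hl (hA.pos k l hkl), b2 k hk (hA.diag k)⟩
  refine le_trans ?_ (Finset.single_le_sum (fun k _ => mul_nonneg
    (Finset.sum_nonneg fun i _ => nn1 k i) (Finset.sum_nonneg fun i _ => nn2 k i))
    (Finset.mem_univ k))
  nlinarith [mul_nonneg (sub_nonneg.2 hle.1) (sub_nonneg.2 hle.2), hle.1, hle.2]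

/-- One averaging step loses at least `w / 2` times the squared gaps at the crossed cuts. -/
theorem IsMixing.sum_gap_le_energy_drop {w : ℝ} (hw : 0 < w) {A : Matrix V V ℝ}
    (hA : IsMixing w A) {rk : V → ℕ} {u : ℕ → ℝ} (hu : Monotone u) (x : V → ℝ) (D : Finset ℕ)
    (hD : ∀ d ∈ D, RespectsCut rk u x d ∧ CrossesCut rk A d) :
    w / 2 * ∑ d ∈ D, (u (d + 1) - u d) ^ 2 ≤
      ∑ i, x i ^ 2 - ∑ k, (∑ i, A k i * x i) ^ 2 := by
  have h1 : ∑ k, ∑ i, A k i * x i ^ 2 = ∑ i, x i ^ 2 := by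
    rw [Finset.sum_comm]
    simp_rw [← Finset.sum_mul, hA.col, one_mul]
  rw [← h1, ← Finset.sum_sub_distrib]
  refine le_trans ?_ (Finset.sum_le_sum fun k _ => sum_gap_mul_le_variance hu (A k) x
    (hA.nonneg k) (hA.row k) D fun d hd => (hD d hd).1)
  rw [Finset.sum_comm, Finset.mul_sum]
  refine Finset.sum_le_sum fun d hd => ?_
  rw [← Finset.mul_sum, mul_comm]
  exact mul_le_mul_of_nonneg_left (hA.half_le_sum_cut hw (hD d hd).2) (sq_nonneg _)

theorem IsMixing.respectsCut {w : ℝ} {A : Matrix V V ℝ} (hA : IsMixing w A) {rk : V → ℕ}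
    {u : ℕ → ℝ} {x : V → ℝ} {d : ℕ} (hx : RespectsCut rk u x d) (hd : ¬ CrossesCut rk A d) :
    RespectsCut rk u (fun k => ∑ i, A k i * x i) d := by
  have h0 : ∀ k i, ¬ (rk k ≤ d ↔ rk i ≤ d) → A k i = 0 := by
    intro k i h
    by_contra h'
    exact hd ⟨k, i, lt_of_le_of_ne (hA.nonneg k i) (Ne.symm h'), h⟩
  intro k
  constructor
  · intro hk
    calc ∑ i, A k i * x i ≤ ∑ i, A k i * u d := by
          refine Finset.sum_le_sum fun i _ => ?_
          by_cases hi : rk i ≤ d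
          · exact mul_le_mul_of_nonneg_left ((hx i).1 hi) (hA.nonneg k i)
          · simp [h0 k i fun h => hi (h.1 hk)]
      _ = u d := by rw [← Finset.sum_mul, hA.row, one_mul]
  · intro hk
    calc u (d + 1) = ∑ i, A k i * u (d + 1) := by rw [← Finset.sum_mul, hA.row, one_mul]
      _ ≤ ∑ i, A k i * x i := by
          refine Finset.sum_le_sum fun i _ => ?_
          by_cases hi : rk i ≤ d
          · simp [h0 k i fun h => not_le.2 hk (h.2 hi)]
          · exact mul_le_mul_of_nonneg_left ((hx i).2 (not_le.1 hi)) (hA.nonneg k i)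

/-- `L` successive averaging steps with weights `A s, …, A (s + L - 1)`. -/
def mixSteps {E : Type*} [AddCommGroup E] [Module ℝ E] (A : ℕ → Matrix V V ℝ) :
    ℕ → ℕ → (V → E) → V → E
  | _, 0, z => z
  | s, L + 1, z => mixSteps A (s + 1) L fun i => ∑ j, A s i j • z j

theorem sum_gap_le_energy_drop_mixSteps {w : ℝ} (hw : 0 < w) {A : ℕ → Matrix V V ℝ}
    (hA : ∀ t, IsMixing w (A t)) {rk : V → ℕ} {u : ℕ → ℝ} (hu : Monotone u) (L : ℕ) :
    ∀ (s : ℕ) (x : V → ℝ) (D : Finset ℕ),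
      (∀ d ∈ D, RespectsCut rk u x d ∧ ∃ l < L, CrossesCut rk (A (s + l)) d) →
      w / 2 * ∑ d ∈ D, (u (d + 1) - u d) ^ 2 ≤
        ∑ i, x i ^ 2 - ∑ i, mixSteps A s L x i ^ 2 := by
  classical
  induction L with
  | zero =>
    intro s x D hD
    have : D = ∅ := Finset.eq_empty_of_forall_notMem fun d hd => by
      obtain ⟨_, l, hl, _⟩ := hD d hd
      omega
    simp [this, mixSteps]
  | succ L ih =>
    intro s x D hD
    rw [← Finset.sum_filter_add_sum_filter_not D (fun d => CrossesCut rk (A s) d), mul_add]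
    have h1 := (hA s).sum_gap_le_energy_drop hw hu x (D.filter fun d => CrossesCut rk (A s) d)
      fun d hd => by
        rw [Finset.mem_filter] at hd
        exact ⟨(hD d hd.1).1, hd.2⟩
    have h2 := ih (s + 1) (fun k => ∑ i, A s k i * x i)
      (D.filter fun d => ¬ CrossesCut rk (A s) d) fun d hd => by
        rw [Finset.mem_filter] at hd
        obtain ⟨hr, l, hl, hc⟩ := hD d hd.1
        refine ⟨(hA s).respectsCut hr hd.2, ?_⟩
        cases l with
        | zero => exact absurd hc hd.2
        | succ l => exact ⟨l, by omega, by rwa [add_right_comm, add_assoc]⟩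
    have h3 : mixSteps A s (L + 1) x = mixSteps A (s + 1) L fun k => ∑ i, A s k i * x i := rfl
    rw [h3]
    linarith

end Mixing

/-- Over a strongly connected period, averaging contracts the energy of a centred vector. -/
theorem energy_mixSteps_le {n : ℕ} {w : ℝ} (hw : 0 < w) {A : ℕ → Matrix (Fin n) (Fin n) ℝ}
    (hA : ∀ t, IsMixing w (A t)) {L s : ℕ}
    (hconn : ∀ c d : Fin n,
      Relation.ReflTransGen (fun u v : Fin n => ∃ l < L, 0 < A (s + l) v u) c d)
    (z : Fin n → ℝ) (hz : ∑ i, z i = 0) :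
    ∑ i, mixSteps A s L z i ^ 2 ≤ (1 - w / (n : ℝ) ^ 2) * ∑ i, z i ^ 2 := by
  rcases Nat.eq_zero_or_pos n with rfl | hn
  · simp
  have hn' : (0 : ℝ) < n := Nat.cast_pos.2 hn
  set τ := Tuple.sort z with hτ
  have hmono : Monotone (z ∘ τ) := Tuple.monotone_sort z
  set u : ℕ → ℝ := fun k => z (τ ⟨min k (n - 1), by omega⟩) with hu_def
  have hu : Monotone u := by
    intro a b hab
    apply hmono
    simp only [Fin.mk_le_mk]
    omega
  set rk : Fin n → ℕ := fun i => (τ.symm i : ℕ) with hrk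
  have hlt : ∀ i, rk i < n := fun i => (τ.symm i).2
  have hzu : ∀ i, z i = u (rk i) := by
    intro i
    have h : (⟨min (rk i) (n - 1), by omega⟩ : Fin n) = τ.symm i := by
      ext; have := hlt i; simp only [hrk] at *; omega
    simp only [hu_def, h, Equiv.apply_symm_apply]
  have hdrop := sum_gap_le_energy_drop_mixSteps hw hA hu L s z (Finset.range (n - 1)) (rk := rk)
    fun d hd => by
      rw [Finset.mem_range] at hd
      refine ⟨fun i => ⟨fun h => (hzu i).le.trans (hu h), fun h => (hu h).trans (hzu i).ge⟩, ?_⟩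
      by_contra hno
      push Not at hno
      have hreach : ∀ v, Relation.ReflTransGen
          (fun u v : Fin n => ∃ l < L, 0 < A (s + l) v u) (τ ⟨0, hn⟩) v → rk v ≤ d := by
        intro v hv
        induction hv with
        | refl => simp [hrk]
        | tail _ hstep ih =>
          obtain ⟨l, hl, hpos⟩ := hstep
          by_contra hcon
          exact hno l hl ⟨_, _, hpos, fun h => hcon (h.2 ih)⟩
      have := hreach (τ ⟨d + 1, by omega⟩) (hconn _ _)
      simp [hrk] at this
  have hcs := sq_sum_le_card_mul_sum_sq (s := Finset.range (n - 1)) (f := fun d => u (d + 1) - u d)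
  rw [Finset.sum_range_sub, Finset.card_range] at hcs
  have hcard : ((n - 1 : ℕ) : ℝ) ≤ n := Nat.cast_le.2 (Nat.sub_le _ _)
  have hS : 0 ≤ ∑ d ∈ Finset.range (n - 1), (u (d + 1) - u d) ^ 2 :=
    Finset.sum_nonneg fun _ _ => sq_nonneg _
  have hdouble : ∑ i, ∑ j, (z i - z j) ^ 2 = 2 * (n : ℝ) * ∑ i, z i ^ 2 := by
    have h : ∀ i j, (z i - z j) ^ 2 = z i ^ 2 + z j ^ 2 - 2 * (z i * z j) := by
      intro i j; ring
    simp_rw [h, Finset.sum_sub_distrib, Finset.sum_add_distrib, ← Finset.mul_sum, hz]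
    simp [← Finset.mul_sum]
    ring
  have hrange : ∀ i j, (z i - z j) ^ 2 ≤ (u (n - 1) - u 0) ^ 2 := by
    have hb : ∀ i, u 0 ≤ z i ∧ z i ≤ u (n - 1) := fun i =>
      ⟨(hu (Nat.zero_le _)).trans (hzu i).ge, (hzu i).le.trans (hu (by have := hlt i; omega))⟩
    intro i j
    apply sq_le_sq'
    · linarith [(hb i).1, (hb j).2]
    · linarith [(hb j).1, (hb i).2]
  have hle : ∑ i, ∑ j, (z i - z j) ^ 2 ≤ (n : ℝ) * (n * (u (n - 1) - u 0) ^ 2) := by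
    calc ∑ i, ∑ j, (z i - z j) ^ 2 ≤ ∑ _i : Fin n, ∑ _j : Fin n, (u (n - 1) - u 0) ^ 2 :=
          Finset.sum_le_sum fun i _ => Finset.sum_le_sum fun j _ => hrange i j
      _ = _ := by simp
  rw [hdouble] at hle
  have h1 : 2 * ∑ i, z i ^ 2 ≤
      (n : ℝ) ^ 2 * ∑ d ∈ Finset.range (n - 1), (u (d + 1) - u d) ^ 2 := by
    have h2 : 2 * ∑ i, z i ^ 2 ≤ n * (u (n - 1) - u 0) ^ 2 := by
      refine le_of_mul_le_mul_left ?_ hn'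
      linarith
    nlinarith [mul_le_mul_of_nonneg_right hcard hS]
  have h3 : w / (n : ℝ) ^ 2 * ∑ i, z i ^ 2 ≤
      w / 2 * ∑ d ∈ Finset.range (n - 1), (u (d + 1) - u d) ^ 2 := by
    rw [div_mul_eq_mul_div, div_le_iff₀ (by positivity)]
    nlinarith
  linarith

section Disagreement

variable {n m : ℕ} {w : ℝ} {A : ℕ → Matrix (Fin n) (Fin n) ℝ}

theorem mixSteps_add {E : Type*} [AddCommGroup E] [Module ℝ E] (s L : ℕ) (z z' : Fin n → E) :
    mixSteps A s L (z + z') = mixSteps A s L z + mixSteps A s L z' := by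
  induction L generalizing s z z' with
  | zero => rfl
  | succ L ih =>
    simp only [mixSteps, ← ih]
    congr 1
    ext i
    simp [smul_add, Finset.sum_add_distrib]

theorem mixSteps_smul {E : Type*} [AddCommGroup E] [Module ℝ E] (s L : ℕ) (κ : ℝ)
    (z : Fin n → E) : mixSteps A s L (κ • z) = κ • mixSteps A s L z := by
  induction L generalizing s z with
  | zero => rfl
  | succ L ih =>
    simp only [mixSteps, ← ih]
    congr 1
    ext i
    simp [Finset.smul_sum, smul_comm κ]

theorem mixSteps_add_steps {E : Type*} [AddCommGroup E] [Module ℝ E] (s a b : ℕ)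
    (z : Fin n → E) :
    mixSteps A s (a + b) z = mixSteps A (s + a) b (mixSteps A s a z) := by
  induction a generalizing s z with
  | zero => simp [mixSteps]
  | succ a ih =>
    rw [add_right_comm, mixSteps, ih, mixSteps, add_assoc s 1 a, add_comm 1 a]

theorem mixSteps_const {E : Type*} [AddCommGroup E] [Module ℝ E] (hA : ∀ t, IsMixing w (A t))
    (s L : ℕ) (e : E) : mixSteps A s L (fun _ : Fin n => e) = fun _ => e := by
  induction L generalizing s with
  | zero => rfl
  | succ L ih => simp only [mixSteps, ← Finset.sum_smul, (hA s).row, one_smul, ih]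

theorem sum_mixSteps {E : Type*} [AddCommGroup E] [Module ℝ E] (hA : ∀ t, IsMixing w (A t))
    (s L : ℕ) (z : Fin n → E) : ∑ i, mixSteps A s L z i = ∑ i, z i := by
  induction L generalizing s z with
  | zero => rfl
  | succ L ih =>
    rw [mixSteps, ih, Finset.sum_comm]
    simp only [← Finset.sum_smul, (hA s).col, one_smul]

theorem mixSteps_apply (s L : ℕ) (z : Fin n → EuclideanSpace ℝ (Fin m)) (i : Fin n)
    (k : Fin m) : mixSteps A s L z i k = mixSteps A s L (fun j => z j k) i := by
  induction L generalizing s z with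
  | zero => rfl
  | succ L ih => simp [mixSteps, ih]

/-- The deviation of a family of vectors from its average. -/
def disagreement (z : Fin n → EuclideanSpace ℝ (Fin m)) : ℝ :=
  ‖(WithLp.toLp 2 (fun i => z i - (n : ℝ)⁻¹ • ∑ j, z j) :
    PiLp 2 fun _ : Fin n => EuclideanSpace ℝ (Fin m))‖

theorem disagreement_nonneg (z : Fin n → EuclideanSpace ℝ (Fin m)) : 0 ≤ disagreement z :=
  norm_nonneg _

theorem disagreement_sq (z : Fin n → EuclideanSpace ℝ (Fin m)) :
    disagreement z ^ 2 = ∑ i, ‖z i - (n : ℝ)⁻¹ • ∑ j, z j‖ ^ 2 :=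
  PiLp.norm_sq_eq_of_L2 _ _

theorem disagreement_add_le (z z' : Fin n → EuclideanSpace ℝ (Fin m)) :
    disagreement (z + z') ≤ disagreement z + disagreement z' := by
  refine le_trans (le_of_eq ?_) (norm_add_le _ _)
  unfold disagreement
  congr 1
  ext i k
  simp [Finset.sum_add_distrib]
  ring

theorem disagreement_smul {κ : ℝ} (hκ : 0 ≤ κ) (z : Fin n → EuclideanSpace ℝ (Fin m)) :
    disagreement (κ • z) = κ * disagreement z := by
  unfold disagreement
  rw [← abs_of_nonneg hκ, ← Real.norm_eq_abs, ← norm_smul, Real.norm_eq_abs, abs_of_nonneg hκ]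
  congr 1
  ext i k
  simp [← Finset.mul_sum]
  ring

theorem disagreement_le {B : ℝ} (hB : 0 ≤ B) (z : Fin n → EuclideanSpace ℝ (Fin m))
    (hz : ∀ i, ‖z i‖ ≤ B) : disagreement z ≤ √n * B := by
  rcases Nat.eq_zero_or_pos n with rfl | hn
  · have : disagreement z ^ 2 = 0 := by rw [disagreement_sq]; simp
    simp [pow_eq_zero_iff two_ne_zero |>.1 this]
  have hn' : (n : ℝ) ≠ 0 := by positivity
  refine le_of_sq_le_sq ?_ (by positivity)
  rw [disagreement_sq, mul_pow, Real.sq_sqrt (Nat.cast_nonneg n)]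
  have h : ∀ i, ‖z i - (n : ℝ)⁻¹ • ∑ j, z j‖ ^ 2 =
      ‖z i‖ ^ 2 - 2 * ⟪z i, (n : ℝ)⁻¹ • ∑ j, z j⟫ + ‖(n : ℝ)⁻¹ • ∑ j, z j‖ ^ 2 := fun i =>
    norm_sub_sq_real _ _
  have h' : ∑ i, ⟪z i, (n : ℝ)⁻¹ • ∑ j, z j⟫ = n * ‖(n : ℝ)⁻¹ • ∑ j, z j‖ ^ 2 := by
    rw [← sum_inner, ← real_inner_self_eq_norm_sq, ← real_inner_smul_left, smul_smul,
      mul_inv_cancel₀ hn', one_smul]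
  simp_rw [h, Finset.sum_add_distrib, Finset.sum_sub_distrib, ← Finset.mul_sum, h']
  have h2 : ∑ i, ‖z i‖ ^ 2 ≤ n * B ^ 2 := by
    calc ∑ i, ‖z i‖ ^ 2 ≤ ∑ _i : Fin n, B ^ 2 :=
          Finset.sum_le_sum fun i _ => pow_le_pow_left₀ (norm_nonneg _) (hz i) 2
      _ = n * B ^ 2 := by simp
  have h3 : 0 ≤ n * ‖(n : ℝ)⁻¹ • ∑ j, z j‖ ^ 2 := by positivity
  simp only [Finset.sum_const, Finset.card_univ, Fintype.card_fin, nsmul_eq_mul]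
  linarith

theorem sum_norm_sub_average_le (z : Fin n → EuclideanSpace ℝ (Fin m)) :
    ∑ i, ‖z i - (n : ℝ)⁻¹ • ∑ j, z j‖ ≤ √n * disagreement z := by
  refine le_of_sq_le_sq ?_
    (mul_nonneg (Real.sqrt_nonneg _) (disagreement_nonneg z))
  rw [mul_pow, Real.sq_sqrt (Nat.cast_nonneg n), disagreement_sq]
  simpa using sq_sum_le_card_mul_sum_sq (s := Finset.univ)
    (f := fun i => ‖z i - (n : ℝ)⁻¹ • ∑ j, z j‖)

/-- Coordinatewise contraction of the energy of centred vectors contracts the disagreement. -/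
theorem disagreement_mixSteps_le_of_energy (hA : ∀ t, IsMixing w (A t)) {s L : ℕ} {c : ℝ}
    (hc : 0 ≤ c)
    (h : ∀ x : Fin n → ℝ, ∑ i, x i = 0 → ∑ i, mixSteps A s L x i ^ 2 ≤ c ^ 2 * ∑ i, x i ^ 2)
    (z : Fin n → EuclideanSpace ℝ (Fin m)) :
    disagreement (mixSteps A s L z) ≤ c * disagreement z := by
  rcases Nat.eq_zero_or_pos n with rfl | hn
  · rw [Subsingleton.elim (mixSteps A s L z) z]
    have : disagreement z ^ 2 = 0 := by rw [disagreement_sq]; simp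
    simp [pow_eq_zero_iff two_ne_zero |>.1 this]
  have hn' : (n : ℝ) ≠ 0 := by positivity
  refine le_of_sq_le_sq ?_ (mul_nonneg hc (disagreement_nonneg z))
  rw [mul_pow, disagreement_sq, disagreement_sq, sum_mixSteps hA]
  set e := (n : ℝ)⁻¹ • ∑ j, z j with he
  set y : Fin n → EuclideanSpace ℝ (Fin m) := fun i => z i - e with hy
  have hz : z = y + fun _ => e := by ext i k; simp [hy]
  have hmix : ∀ i, mixSteps A s L z i - e = mixSteps A s L y i := by
    intro i
    rw [hz, mixSteps_add, mixSteps_const hA]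
    simp
  have hy0 : ∑ i, y i = 0 := by
    simp only [hy, Finset.sum_sub_distrib, Finset.sum_const, Finset.card_univ, Fintype.card_fin,
      he, ← Nat.cast_smul_eq_nsmul ℝ, smul_smul, mul_inv_cancel₀ hn', one_smul, sub_self]
  simp_rw [hmix, EuclideanSpace.norm_sq_eq, Real.norm_eq_abs, sq_abs, mixSteps_apply]
  rw [Finset.sum_comm, Finset.sum_comm (s := Finset.univ (α := Fin n)), Finset.mul_sum]
  refine Finset.sum_le_sum fun k _ => h (fun i => y i k) ?_
  simpa using congrArg (fun v : EuclideanSpace ℝ (Fin m) => v k) hy0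

theorem disagreement_mixSteps_le (hw : 0 < w) (hA : ∀ t, IsMixing w (A t)) (s L : ℕ)
    (z : Fin n → EuclideanSpace ℝ (Fin m)) :
    disagreement (mixSteps A s L z) ≤ disagreement z := by
  have h := disagreement_mixSteps_le_of_energy hA (s := s) (L := L) zero_le_one (fun x _ => ?_) z
  · rwa [one_mul] at h
  · have := sum_gap_le_energy_drop_mixSteps hw hA (rk := fun _ => 0) (u := fun _ => 0)
      monotone_const L s x ∅ (by simp)
    simp at this
    linarith

theorem disagreement_mixSteps_period_le (hw : 0 < w) (hw1 : w < 1)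
    (hA : ∀ t, IsMixing w (A t)) {s L : ℕ}
    (hconn : ∀ c d : Fin n,
      Relation.ReflTransGen (fun u v : Fin n => ∃ l < L, 0 < A (s + l) v u) c d)
    (z : Fin n → EuclideanSpace ℝ (Fin m)) :
    disagreement (mixSteps A s L z) ≤ (1 - w / (2 * (n : ℝ) ^ 2)) * disagreement z := by
  have hc : 0 ≤ 1 - w / (2 * (n : ℝ) ^ 2) := by
    rcases Nat.eq_zero_or_pos n with rfl | hn
    · simp
    have : (1 : ℝ) ≤ n := Nat.one_le_cast.2 hn
    rw [sub_nonneg, div_le_one (by positivity)]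
    nlinarith
  refine disagreement_mixSteps_le_of_energy hA hc (fun x hx => ?_) z
  refine (energy_mixSteps_le hw hA hconn x hx).trans ?_
  refine mul_le_mul_of_nonneg_right ?_ (Finset.sum_nonneg fun _ _ => sq_nonneg _)
  have : w / (n : ℝ) ^ 2 = 2 * (w / (2 * (n : ℝ) ^ 2)) := by
    rw [mul_comm 2 ((n : ℝ) ^ 2), ← div_div]; ring
  rw [this]
  nlinarith [sq_nonneg (w / (2 * (n : ℝ) ^ 2))]

theorem disagreement_mixSteps_le_geometric (hw : 0 < w) (hA : ∀ t, IsMixing w (A t)) {N : ℕ}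
    (hN : 0 < N) {μ : ℝ} (hμ0 : 0 < μ) (hμ1 : μ ≤ 1)
    (hper : ∀ s (z : Fin n → EuclideanSpace ℝ (Fin m)),
      disagreement (mixSteps A s N z) ≤ μ ^ N * disagreement z)
    (s L : ℕ) (z : Fin n → EuclideanSpace ℝ (Fin m)) :
    disagreement (mixSteps A s L z) ≤ (μ ^ N)⁻¹ * μ ^ L * disagreement z := by
  have hpow : ∀ k s (z : Fin n → EuclideanSpace ℝ (Fin m)),
      disagreement (mixSteps A s (N * k) z) ≤ (μ ^ N) ^ k * disagreement z := by
    intro k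
    induction k with
    | zero => intro s z; simp [mixSteps]
    | succ k ih =>
      intro s z
      rw [Nat.mul_succ, mixSteps_add_steps, pow_succ']
      refine (hper _ _).trans ?_
      rw [mul_assoc]
      exact mul_le_mul_of_nonneg_left (ih s z) (by positivity)
  have hL := Nat.div_add_mod L N
  have hr := (Nat.mod_lt L hN).le
  have h1 : disagreement (mixSteps A s L z) ≤ (μ ^ N) ^ (L / N) * disagreement z := by
    conv_lhs => rw [← hL, mixSteps_add_steps]
    exact (disagreement_mixSteps_le hw hA _ _ _).trans (hpow _ _ _)
  refine h1.trans (mul_le_mul_of_nonneg_right ?_ (disagreement_nonneg z))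
  rw [inv_mul_eq_div, le_div_iff₀ (by positivity)]
  conv_rhs => rw [← hL, pow_add, pow_mul]
  exact mul_le_mul_of_nonneg_left (pow_le_pow_of_le_one hμ0.le hμ1 hr) (by positivity)

end Disagreement

/-- Three-point inequality for a minimizer of a linear-plus-convex function regularized by a
Bregman divergence. -/
theorem breg_three_point {d : ℕ} {ψ : EuclideanSpace ℝ (Fin d) → ℝ}
    {ψ' : EuclideanSpace ℝ (Fin d) → EuclideanSpace ℝ (Fin d)}
    {X : Set (EuclideanSpace ℝ (Fin d))} (hX : Convex ℝ X) {r : EuclideanSpace ℝ (Fin d) → ℝ}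
    (hr : ConvexOn ℝ X r) {α : ℝ} (hα : 0 ≤ α) {a x v y : EuclideanSpace ℝ (Fin d)}
    (hψ : HasGradientAt ψ (ψ' v) v) (hv : v ∈ X) (hy : y ∈ X)
    (hmin : ∀ z ∈ X, α * ⟪v, a⟫ + α * r v + breg ψ ψ' v x ≤
      α * ⟪z, a⟫ + α * r z + breg ψ ψ' z x) :
    α * ⟪v - y, a⟫ + α * (r v - r y) ≤ breg ψ ψ' y x - breg ψ ψ' y v - breg ψ ψ' v x := by
  have hlim := (hψ.hasFDerivAt.hasLineDerivAt (y - v)).tendsto_slope_zero_right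
  rw [InnerProductSpace.toDual_apply_apply] at hlim
  have hev : ∀ᶠ s : ℝ in nhdsWithin 0 (Set.Ioi 0),
      α * ⟪v - y, a⟫ + α * (r v - r y) + ⟪ψ' x, y - v⟫ ≤
        s⁻¹ • (ψ (v + s • (y - v)) - ψ v) := by
    filter_upwards [Ioc_mem_nhdsGT (zero_lt_one' ℝ)] with s hs
    rw [smul_eq_mul, inv_mul_eq_div, le_div_iff₀ hs.1]
    have hz : v + s • (y - v) = (1 - s) • v + s • y := by module
    have h1 := hmin (v + s • (y - v)) (by
      rw [hz]; exact hX hv hy (sub_nonneg.2 hs.2) hs.1.le (by ring))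
    have h2 := hr.2 hv hy (sub_nonneg.2 hs.2) hs.1.le (by ring)
    rw [← hz, smul_eq_mul, smul_eq_mul] at h2
    have h3 := mul_le_mul_of_nonneg_left h2 hα
    simp only [breg, inner_add_left, inner_sub_right, inner_add_right, real_inner_smul_left,
      real_inner_smul_right, inner_sub_left] at h1 ⊢
    linarith
  have h := ge_of_tendsto hlim hev
  simp only [breg, inner_sub_right] at h ⊢
  linarith

namespace Alg

variable {n m : ℕ} {p : Fin n → ℕ} (S : Alg n m p)

theorem isMixing (t : ℕ) : IsMixing S.w (S.W t) :=
  ⟨S.hWnonneg t, S.hWrow t, S.hWcol t, S.hWdiag t, S.hWpos t⟩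

theorem x_mem (t : ℕ) (i : Fin n) : S.x t i ∈ S.X i := by
  cases t with
  | zero => exact S.hx0 i
  | succ t =>
    rw [S.hx _ (Nat.le_add_left 1 t)]
    exact S.hΦmaps _ _ _ (S.hxtilmem _ (Nat.le_add_left 1 t) i)

theorem norm_sub_le_dX (i : Fin n) {u v : EuclideanSpace ℝ (Fin (p i))} (hu : u ∈ S.X i)
    (hv : v ∈ S.X i) : ‖u - v‖ ≤ S.dX := by
  have hmem : ∀ z ∈ S.X i, ∀ j, (stack (Function.update (S.x 0) i z)) j ∈ S.X j := by
    intro z hz j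
    change Function.update (S.x 0) i z j ∈ S.X j
    rcases eq_or_ne j i with rfl | h
    · simpa using hz
    · simpa [h] using S.hx0 j
  refine le_trans ?_ (S.hdiam _ _ (hmem u hu) (hmem v hv))
  refine le_trans (le_of_eq ?_) (PiLp.norm_apply_le _ i)
  simp [stack]

theorem q_nonneg (t : ℕ) (i : Fin n) (k : Fin m) : 0 ≤ S.q t i k := by
  cases t with
  | zero => simp [S.hq0]
  | succ t =>
    rw [S.hq _ (Nat.le_add_left 1 t)]
    exact le_max_right _ _

theorem qtil_nonneg (t : ℕ) (i : Fin n) (k : Fin m) : 0 ≤ S.qtil (t + 1) i k := by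
  rw [S.hqtil _ (Nat.le_add_left 1 t)]
  simp only [WithLp.ofLp_sum, WithLp.ofLp_smul, Finset.sum_apply, Pi.smul_apply, smul_eq_mul]
  exact Finset.sum_nonneg fun j _ => mul_nonneg (S.hWnonneg _ _ _) (S.q_nonneg _ _ _)

theorem norm_b_le (t : ℕ) (i : Fin n) : ‖S.b (t + 1) i‖ ≤ S.B1 := by
  rw [S.hb _ (Nat.le_add_left 1 t)]
  have h1 := S.hGgbound t i _ (S.x_mem t i) (S.xtil (t + 1) i - S.x t i)
  have h2 := mul_le_mul_of_nonneg_left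
    (S.norm_sub_le_dX i (S.hxtilmem _ (Nat.le_add_left 1 t) i) (S.x_mem t i)) S.hG.le
  have h3 := S.hgbound t i _ (S.x_mem t i)
  refine (norm_add_le _ _).trans ?_
  rw [B1, Nat.add_sub_cancel]
  linarith [S.hF]

theorem q_one (i : Fin n) : S.q 1 i = 0 := by
  have hqt : S.qtil 1 i = 0 := by rw [S.hqtil 1 le_rfl]; simp [S.hq0]
  rw [S.hq 1 le_rfl, S.hb 1 le_rfl, hqt]
  ext k
  have h := S.hGgsub 0 i _ (S.x_mem 0 i) k _ (S.hxtilmem 1 le_rfl i)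
  simp only [S.hg0, PiLp.zero_apply, zero_add] at h
  simp only [_root_.posPart, vecOf, S.hg0, WithLp.equiv_symm_apply, smul_zero, sub_zero, add_zero,
    zero_add, PiLp.smul_apply, smul_eq_mul, PiLp.zero_apply, tsub_self, max_eq_right_iff]
  exact mul_nonpos_of_nonneg_of_nonpos (S.hγpos 1 le_rfl).le h

/-- The dual update is a common contraction of the mixed dual variables plus a small error. -/
theorem exists_q_eq_smul_add (t : ℕ) : ∃ κ : ℝ, 0 ≤ κ ∧ κ ≤ 1 ∧
    ∃ ε : Fin n → EuclideanSpace ℝ (Fin m),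
      S.q (t + 1) = κ • S.qtil (t + 1) + ε ∧ ∀ i, ‖ε i‖ ≤ S.γ (t + 1) * S.B1 := by
  have hγ := S.hγpos (t + 1) (Nat.le_add_left 1 t)
  have hβ := S.hβpos (t + 1) (Nat.le_add_left 1 t)
  have hγβ := mul_pos hγ hβ
  refine ⟨max (1 - S.γ (t + 1) * S.β (t + 1)) 0, le_max_right _ _,
    max_le (by linarith) zero_le_one,
    S.q (t + 1) - max (1 - S.γ (t + 1) * S.β (t + 1)) 0 • S.qtil (t + 1), by abel, fun i => ?_⟩
  have hcoord : ∀ k, |(S.q (t + 1) - max (1 - S.γ (t + 1) * S.β (t + 1)) 0 •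
      S.qtil (t + 1)) i k| ≤ |(S.γ (t + 1) • S.b (t + 1) i) k| := by
    intro k
    have hq0 := S.qtil_nonneg t i k
    rw [Pi.sub_apply, S.hq _ (Nat.le_add_left 1 t)]
    simp only [_root_.posPart, WithLp.equiv_symm_apply, PiLp.sub_apply, PiLp.add_apply,
      PiLp.smul_apply, Pi.smul_apply, smul_eq_mul]
    generalize S.qtil (t + 1) i k = a at *
    generalize S.b (t + 1) i k = b at *
    have e : a + S.γ (t + 1) * (b - S.β (t + 1) * a) =
        (1 - S.γ (t + 1) * S.β (t + 1)) * a + S.γ (t + 1) * b := by ring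
    rw [e]
    generalize S.γ (t + 1) * b = g
    have hg1 := le_abs_self g
    have hg2 := neg_abs_le g
    rcases le_total 0 (1 - S.γ (t + 1) * S.β (t + 1)) with h | h
    · rw [max_eq_left h]
      have h0 := mul_nonneg h hq0
      rw [abs_le]
      constructor
      · linarith [le_max_left ((1 - S.γ (t + 1) * S.β (t + 1)) * a + g) 0]
      · rw [sub_le_iff_le_add]
        exact max_le (by linarith) (by linarith [abs_nonneg g])
    · rw [max_eq_right h, zero_mul, sub_zero, abs_of_nonneg (le_max_right _ _)]
      have h0 := mul_nonpos_of_nonpos_of_nonneg h hq0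
      exact max_le (by linarith) (abs_nonneg g)
  calc _ ≤ ‖S.γ (t + 1) • S.b (t + 1) i‖ := by
        refine le_of_sq_le_sq ?_ (norm_nonneg _)
        rw [EuclideanSpace.norm_sq_eq, EuclideanSpace.norm_sq_eq]
        exact Finset.sum_le_sum fun k _ => pow_le_pow_left₀ (norm_nonneg _) (hcoord k) 2
    _ ≤ S.γ (t + 1) * S.B1 := by
        rw [norm_smul, Real.norm_of_nonneg hγ.le]
        exact mul_le_mul_of_nonneg_left (S.norm_b_le t i) hγ.le

theorem B1_pos : 0 < S.B1 := by
  have := S.hF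
  have := mul_pos S.hG S.hdX
  unfold B1
  linarith

theorem one_le_n (S : Alg n m p) : (1 : ℝ) ≤ n := Nat.one_le_cast.2 S.hn

theorem contraction_pos : 0 < 1 - S.w / (2 * (n : ℝ) ^ 2) := by
  have := S.one_le_n
  rw [sub_pos, div_lt_one (by positivity)]
  nlinarith [S.hw1]

theorem contraction_le_one : 1 - S.w / (2 * (n : ℝ) ^ 2) ≤ 1 := by
  have := S.one_le_n
  have := S.hw0
  rw [sub_le_self_iff]
  positivity

theorem lam_pow_iota : S.lam ^ S.iota = 1 - S.w / (2 * (n : ℝ) ^ 2) :=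
  Real.rpow_inv_natCast_pow S.contraction_pos.le S.hiota.ne'

theorem lam_pos : 0 < S.lam := Real.rpow_pos_of_pos S.contraction_pos _

theorem lam_le_one : S.lam ≤ 1 :=
  Real.rpow_le_one S.contraction_pos.le S.contraction_le_one (by positivity)

theorem disagreement_mixSteps_W_le (s L : ℕ) (z : Fin n → EuclideanSpace ℝ (Fin m)) :
    disagreement (mixSteps S.W s L z) ≤
      (1 - S.w / (2 * (n : ℝ) ^ 2))⁻¹ * S.lam ^ L * disagreement z := by
  have h := disagreement_mixSteps_le_geometric S.hw0 S.isMixing S.hiota S.lam_pos S.lam_le_one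
    (m := m) (fun s z => by
      rw [S.lam_pow_iota]
      exact disagreement_mixSteps_period_le S.hw0 S.hw1 S.isMixing (S.hconn s) z) s L z
  rwa [S.lam_pow_iota] at h

theorem disagreement_mixSteps_q_le (t : ℕ) : ∀ L : ℕ,
    disagreement (mixSteps S.W (t + 1) L (S.q (t + 1))) ≤
      (1 - S.w / (2 * (n : ℝ) ^ 2))⁻¹ * (√n * S.B1) *
        ∑ s ∈ Finset.Icc 1 t, S.γ (s + 1) * S.lam ^ (t - s + L) := by
  have hc := inv_pos.2 S.contraction_pos
  induction t with
  | zero =>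
    intro L
    have hq : S.q (0 + 1) = (0 : ℝ) • S.q 1 := by
      ext i k
      simp [S.q_one]
    rw [hq, mixSteps_smul, disagreement_smul le_rfl]
    simp
  | succ t ih =>
    intro L
    obtain ⟨κ, hκ0, hκ1, ε, hq, hε⟩ := S.exists_q_eq_smul_add (t + 1)
    have hqt : mixSteps S.W (t + 1 + 1) L (S.qtil (t + 1 + 1)) =
        mixSteps S.W (t + 1) (L + 1) (S.q (t + 1)) := by
      rw [mixSteps]
      congr 1
      ext1 i
      rw [S.hqtil _ (Nat.le_add_left 1 _), Nat.add_sub_cancel]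
    have hγB := mul_nonneg (S.hγpos (t + 1 + 1) (Nat.le_add_left 1 _)).le S.B1_pos.le
    have h1 : κ * disagreement (mixSteps S.W (t + 1) (L + 1) (S.q (t + 1))) ≤
        (1 - S.w / (2 * (n : ℝ) ^ 2))⁻¹ * (√n * S.B1) *
          ∑ s ∈ Finset.Icc 1 t, S.γ (s + 1) * S.lam ^ (t - s + (L + 1)) :=
      (mul_le_of_le_one_left (disagreement_nonneg _) hκ1).trans (ih (L + 1))
    have h2 : disagreement (mixSteps S.W (t + 1 + 1) L ε) ≤
        (1 - S.w / (2 * (n : ℝ) ^ 2))⁻¹ * S.lam ^ L * (√n * (S.γ (t + 1 + 1) * S.B1)) :=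
      (S.disagreement_mixSteps_W_le _ _ _).trans
        (mul_le_mul_of_nonneg_left (disagreement_le hγB ε hε)
          (mul_nonneg hc.le (pow_nonneg S.lam_pos.le _)))
    have h3 : ∑ s ∈ Finset.Icc 1 (t + 1), S.γ (s + 1) * S.lam ^ (t + 1 - s + L) =
        ∑ s ∈ Finset.Icc 1 t, S.γ (s + 1) * S.lam ^ (t - s + (L + 1)) +
          S.γ (t + 1 + 1) * S.lam ^ L := by
      rw [Finset.sum_Icc_succ_top (by omega), Nat.sub_self, zero_add]
      congr 1
      refine Finset.sum_congr rfl fun s hs => ?_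
      rw [Finset.mem_Icc] at hs
      congr 2
      omega
    rw [hq, mixSteps_add, mixSteps_smul, hqt, h3]
    refine (disagreement_add_le _ _).trans ?_
    rw [disagreement_smul hκ0]
    refine (add_le_add h1 h2).trans (le_of_eq ?_)
    ring

/-- The mixed dual variables stay close to the average dual variable. -/
theorem sum_norm_qtil_sub_qbar_le (t : ℕ) :
    (∑ i, ‖S.qtil (t + 1 + 1) i - S.qbar (t + 1)‖) * S.F ≤ S.E1 (t + 1 + 1) := by
  have hmix : mixSteps S.W (t + 1) 1 (S.q (t + 1)) = S.qtil (t + 1 + 1) := by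
    ext1 i
    rw [S.hqtil _ (Nat.le_add_left 1 _), Nat.add_sub_cancel]
    rfl
  have hmean : S.qbar (t + 1) = (n : ℝ)⁻¹ • ∑ i, S.qtil (t + 1 + 1) i := by
    rw [← hmix, sum_mixSteps S.isMixing, qbar]
  have h1 := S.disagreement_mixSteps_q_le t 1
  rw [hmix] at h1
  have h2 := sum_norm_sub_average_le (S.qtil (t + 1 + 1))
  rw [← hmean] at h2
  set c := 1 - S.w / (2 * (n : ℝ) ^ 2) with hc
  have hc0 : 0 < c := S.contraction_pos
  have hc1 : c ≤ 1 := S.contraction_le_one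
  have hn := S.one_le_n
  have hB := S.B1_pos
  set T := ∑ s ∈ Finset.Icc 1 (t + 1), S.γ (s + 1) * S.lam ^ (t + 1 - s) with hT
  have hT0 : 0 ≤ T := Finset.sum_nonneg fun s _ =>
    mul_nonneg (S.hγpos _ (Nat.le_add_left 1 s)).le (pow_nonneg S.lam_pos.le _)
  have hsum : ∑ s ∈ Finset.Icc 1 t, S.γ (s + 1) * S.lam ^ (t - s + 1) ≤ T := by
    rw [hT, Finset.sum_Icc_succ_top (by omega)]
    refine le_add_of_le_of_nonneg (Finset.sum_le_sum fun s hs => le_of_eq ?_)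
      (mul_nonneg (S.hγpos _ (Nat.le_add_left 1 _)).le (pow_nonneg S.lam_pos.le _))
    rw [Finset.mem_Icc] at hs
    congr 2
    omega
  have hcc : c⁻¹ ≤ (c ^ 2)⁻¹ :=
    inv_anti₀ (by positivity) (pow_le_of_le_one hc0.le hc1 two_ne_zero)
  have h3 : ∑ i, ‖S.qtil (t + 1 + 1) i - S.qbar (t + 1)‖ ≤
      (n : ℝ) ^ 2 * (c ^ 2)⁻¹ * S.B1 * T := by
    calc _ ≤ √n * (c⁻¹ * (√n * S.B1) * T) :=
          h2.trans (mul_le_mul_of_nonneg_left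
            (h1.trans (mul_le_mul_of_nonneg_left hsum (by positivity))) (Real.sqrt_nonneg _))
      _ = (√n * √n) * c⁻¹ * S.B1 * T := by ring
      _ = n * c⁻¹ * S.B1 * T := by rw [Real.mul_self_sqrt (Nat.cast_nonneg n)]
      _ ≤ (n : ℝ) ^ 2 * (c ^ 2)⁻¹ * S.B1 * T := by
          gcongr
          nlinarith
  have hE : S.E1 (t + 1 + 1) = (n : ℝ) ^ 2 * (c ^ 2)⁻¹ * S.B1 * T * S.F := by
    simp only [E1, tau, Nat.add_sub_cancel]
    ring
  rw [hE]
  exact mul_le_mul_of_nonneg_right h3 S.hF.le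

theorem sigmin_pos : 0 < S.sigmin := by
  rw [sigmin, Finset.lt_inf'_iff]
  exact fun i _ => S.hσ i

theorem sigmin_le (i : Fin n) : S.sigmin ≤ S.σ i := Finset.inf'_le _ (Finset.mem_univ i)

/-- Per-agent primal-dual descent inequality. -/
theorem agent_descent (y : ℕ → ∀ i, EuclideanSpace ℝ (Fin (p i))) (hy : ∀ t i, y t i ∈ S.X i)
    (t : ℕ) (i : Fin n) :
    ⟪S.qtil (t + 1) i, S.g t i (S.x t i)⟫ + (S.f t i (S.x t i) + S.r t i (S.x t i))
        - (S.f t i (y t i) + S.r t i (y t i))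
      ≤ ⟪S.qtil (t + 1) i, S.g t i (y t i)⟫
        + (S.α (t + 1))⁻¹ * (breg (S.ψ i) (S.ψ' i) (y t i) (S.x t i)
            - breg (S.ψ i) (S.ψ' i) (y (t + 1) i) (S.x (t + 1) i))
        + 4 * S.G ^ 2 * S.α (t + 1) / S.sigmin
        + S.K / S.α (t + 1) * ‖y (t + 1) i - S.Φ (t + 1) i (y t i)‖
        - ⟪S.qtil (t + 1) i,
            vecOf fun j => ⟪S.Gg t i (S.x t i) j, S.xtil (t + 1) i - S.x t i⟫⟫
        - S.sigmin / (4 * S.α (t + 1)) * ‖S.xtil (t + 1) i - S.x t i‖ ^ 2 := by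
  have hα := S.hαpos (t + 1) (Nat.le_add_left 1 t)
  have hxm := S.x_mem t i
  have hxt := S.hxtilmem (t + 1) (Nat.le_add_left 1 t) i
  have hym := hy t i
  have hmin := S.hxtilmin (t + 1) (Nat.le_add_left 1 t) i
  have ha := S.ha (t + 1) (Nat.le_add_left 1 t) i
  have hxΦ := S.hx (t + 1) (Nat.le_add_left 1 t) i
  rw [Nat.add_sub_cancel] at hmin ha
  have h3p := breg_three_point (S.hXconvex i) (S.hrconvex t i) hα.le
    (S.hψgrad i (S.xtil (t + 1) i)) hxt hym hmin
  have hΦ := S.hΦcontract (t + 1) i _ hym _ hxt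
  have hLip := (le_abs_self _).trans (S.hbregLip i _ (hy (t + 1) i) _
    (S.hΦmaps (t + 1) i _ hym) _ (S.x_mem (t + 1) i))
  rw [hxΦ] at hLip
  have hstrong := S.hψstrong i _ hxt _ hxm
  have hf := S.hGfsub t i _ hxm _ hym
  have hr := S.hGrsub t i _ hxm _ hxt
  have hgsum : ⟪S.qtil (t + 1) i, S.g t i (S.x t i)⟫ +
      ⟪∑ j, S.qtil (t + 1) i j • S.Gg t i (S.x t i) j, y t i - S.x t i⟫ ≤
        ⟪S.qtil (t + 1) i, S.g t i (y t i)⟫ := by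
    simp only [PiLp.inner_apply (𝕜 := ℝ) (S.qtil (t + 1) i), sum_inner, real_inner_smul_left]
    rw [← Finset.sum_add_distrib]
    refine Finset.sum_le_sum fun j _ => ?_
    have h := mul_le_mul_of_nonneg_left (S.hGgsub t i _ hxm j _ hym) (S.qtil_nonneg t i j)
    simp only [RCLike.inner_apply, conj_trivial]
    linarith
  have hGg : ⟪S.qtil (t + 1) i,
      vecOf fun j => ⟪S.Gg t i (S.x t i) j, S.xtil (t + 1) i - S.x t i⟫⟫ =
        ⟪∑ j, S.qtil (t + 1) i j • S.Gg t i (S.x t i) j, S.xtil (t + 1) i - S.x t i⟫ := by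
    simp only [PiLp.inner_apply (𝕜 := ℝ) (S.qtil (t + 1) i), sum_inner, real_inner_smul_left,
      vecOf, WithLp.equiv_symm_apply, RCLike.inner_apply, conj_trivial]
    exact Finset.sum_congr rfl fun j _ => mul_comm _ _
  have hGf := (neg_le_abs _).trans ((abs_real_inner_le_norm (S.Gf t i (S.x t i))
    (S.xtil (t + 1) i - S.x t i)).trans
      (mul_le_mul_of_nonneg_right (S.hGfbound t i _ hxm) (norm_nonneg _)))
  have hGr := (neg_le_abs _).trans ((abs_real_inner_le_norm (S.Gr t i (S.x t i))
    (S.xtil (t + 1) i - S.x t i)).trans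
      (mul_le_mul_of_nonneg_right (S.hGrbound t i _ hxm) (norm_nonneg _)))
  rw [hGg, hxΦ]
  rw [ha] at h3p
  set N := ‖S.xtil (t + 1) i - S.x t i‖ with hN
  have hN0 : 0 ≤ N := norm_nonneg _
  have hσ0 := S.sigmin_pos
  have hσN : S.sigmin / 2 * N ^ 2 ≤ breg (S.ψ i) (S.ψ' i) (S.xtil (t + 1) i) (S.x t i) := by
    have := mul_le_mul_of_nonneg_right (S.sigmin_le i) (sq_nonneg N)
    simp only [breg]
    linarith
  have hamgm : 2 * S.G * N ≤
      S.sigmin / (4 * S.α (t + 1)) * N ^ 2 + 4 * S.G ^ 2 * S.α (t + 1) / S.sigmin := by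
    have h : S.sigmin / (4 * S.α (t + 1)) * N ^ 2 + 4 * S.G ^ 2 * S.α (t + 1) / S.sigmin
        - 2 * S.G * N =
          (S.sigmin * N - 4 * S.G * S.α (t + 1)) ^ 2 / (4 * S.α (t + 1) * S.sigmin) := by
      field_simp
      ring
    have h' : 0 ≤ (S.sigmin * N - 4 * S.G * S.α (t + 1)) ^ 2 /
        (4 * S.α (t + 1) * S.sigmin) := by positivity
    linarith
  have hmain : ⟪S.xtil (t + 1) i - y t i,
        S.Gf t i (S.x t i) + ∑ j, S.qtil (t + 1) i j • S.Gg t i (S.x t i) j⟫ +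
      (S.r t i (S.xtil (t + 1) i) - S.r t i (y t i)) ≤
        (S.α (t + 1))⁻¹ * (breg (S.ψ i) (S.ψ' i) (y t i) (S.x t i)
            - breg (S.ψ i) (S.ψ' i) (y (t + 1) i) (S.Φ (t + 1) i (S.xtil (t + 1) i)))
        + S.K / S.α (t + 1) * ‖y (t + 1) i - S.Φ (t + 1) i (y t i)‖
        - S.sigmin / (2 * S.α (t + 1)) * N ^ 2 := by
    have h : (S.α (t + 1))⁻¹ * (breg (S.ψ i) (S.ψ' i) (y t i) (S.x t i)
            - breg (S.ψ i) (S.ψ' i) (y (t + 1) i) (S.Φ (t + 1) i (S.xtil (t + 1) i)))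
        + S.K / S.α (t + 1) * ‖y (t + 1) i - S.Φ (t + 1) i (y t i)‖
        - S.sigmin / (2 * S.α (t + 1)) * N ^ 2 =
      (breg (S.ψ i) (S.ψ' i) (y t i) (S.x t i)
            - breg (S.ψ i) (S.ψ' i) (y (t + 1) i) (S.Φ (t + 1) i (S.xtil (t + 1) i))
        + S.K * ‖y (t + 1) i - S.Φ (t + 1) i (y t i)‖
        - S.sigmin / 2 * N ^ 2) / S.α (t + 1) := by
      field_simp
    rw [h, le_div_iff₀ hα]
    linarith
  have hhalf : S.sigmin / (2 * S.α (t + 1)) * N ^ 2 =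
      2 * (S.sigmin / (4 * S.α (t + 1)) * N ^ 2) := by
    field_simp
    ring
  rw [hhalf] at hmain
  rw [real_inner_comm] at hmain
  simp only [inner_sub_right, inner_add_left] at hmain hf hr hgsum hGf hGr ⊢
  linarith

end Alg

theorem statement_5 {n m : ℕ} {p : Fin n → ℕ} (S : Alg n m p)
    (y : ℕ → ∀ i, EuclideanSpace ℝ (Fin (p i))) (hy : ∀ t i, y t i ∈ S.X i) :
    ∀ t : ℕ, 1 ≤ t →
      ⟪S.qbar t, S.gsum t (S.x t)⟫ + S.fsum t (S.x t) - S.fsum t (y t)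
        ≤ ⟪S.qbar t, S.gsum t (y t)⟫ + 2 * S.E1 (t + 1) + S.E2 y (t + 1)
          + 4 * (n : ℝ) * S.G ^ 2 * S.α (t + 1) / S.sigmin
          + S.K / S.α (t + 1) * ∑ i, ‖y (t + 1) i - S.Φ (t + 1) i (y t i)‖
          - ∑ i, ⟪S.qtil (t + 1) i,
              vecOf fun j => ⟪S.Gg t i (S.x t i) j, S.xtil (t + 1) i - S.x t i⟫⟫
          - S.sigmin / (4 * S.α (t + 1)) * ∑ i, ‖S.xtil (t + 1) i - S.x t i‖ ^ 2 := by
  intro t ht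
  obtain ⟨s, rfl⟩ : ∃ s, t = s + 1 := ⟨t - 1, by omega⟩
  have hdesc := Finset.sum_le_sum fun i (_ : i ∈ Finset.univ) => S.agent_descent y hy (s + 1) i
  simp only [Finset.sum_add_distrib, Finset.sum_sub_distrib, ← Finset.mul_sum, Finset.sum_const,
    Finset.card_univ, Fintype.card_fin, nsmul_eq_mul] at hdesc
  have hcons : ∑ i, (⟪S.qbar (s + 1), S.g (s + 1) i (S.x (s + 1) i)⟫
        - ⟪S.qbar (s + 1), S.g (s + 1) i (y (s + 1) i)⟫
        - (⟪S.qtil (s + 1 + 1) i, S.g (s + 1) i (S.x (s + 1) i)⟫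
        - ⟪S.qtil (s + 1 + 1) i, S.g (s + 1) i (y (s + 1) i)⟫)) ≤ 2 * S.E1 (s + 1 + 1) := by
    refine le_trans ?_ (mul_le_mul_of_nonneg_left (S.sum_norm_qtil_sub_qbar_le s) zero_le_two)
    rw [Finset.sum_mul, Finset.mul_sum]
    refine Finset.sum_le_sum fun i _ => ?_
    rw [← inner_sub_right, ← inner_sub_right, ← inner_sub_left]
    refine (real_inner_le_norm _ _).trans ?_
    rw [norm_sub_rev]
    have h1 := norm_sub_le (S.g (s + 1) i (S.x (s + 1) i)) (S.g (s + 1) i (y (s + 1) i))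
    have h2 := S.hgbound (s + 1) i _ (S.x_mem (s + 1) i)
    have h3 := S.hgbound (s + 1) i _ (hy (s + 1) i)
    have h4 := mul_le_mul_of_nonneg_left (h1.trans (add_le_add h2 h3))
      (norm_nonneg (S.qtil (s + 1 + 1) i - S.qbar (s + 1)))
    linarith
  have hn : (n : ℝ) * (4 * S.G ^ 2 * S.α (s + 1 + 1) / S.sigmin) =
      4 * (n : ℝ) * S.G ^ 2 * S.α (s + 1 + 1) / S.sigmin := by ring
  simp only [Alg.fsum, Alg.gsum, Alg.E2, inner_sum, Finset.sum_sub_distrib,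
    Finset.sum_add_distrib, Nat.add_sub_cancel] at hcons ⊢
  linarith

end
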